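/- The following are equivalent: (i) T^∞_{p,𝓕} f = A(𝔭)·f as functions on ℋ^r; (ii) for every nonzero integral ideal 𝔞 lying in the narrow ideal class of t⁻¹𝔡, one has A(𝔞)·A(𝔭) = A(𝔞𝔭) + N(𝔭)^{k_0−1}·A(𝔞𝔭⁻¹), where by convention A(𝔟)=0 whenever the fractional ideal 𝔟 is not integral. -/

import Mathlib

open NumberField FractionalIdeal Complex
open scoped nonZeroDivisors Classical Real

noncomputable section

variable (F : Type*) [Field F] [NumberField F]

/-- Extension by zero of a coefficient function on integral ideals to all fractional
ideals. -/
def Aext (A : Ideal (𝓞 F) → ℂ) (I : FractionalIdeal (𝓞 F)⁰ F) : ℂ :=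
  if h : ∃ J : Ideal (𝓞 F), (J : FractionalIdeal (𝓞 F)⁰ F) = I then A h.choose else 0

/-- The Fourier coefficient `a(η) = N(t)^{k₀/2} A(ηt⁻¹𝔡) ∏_j (η^{(j)})^{-k'_j/2}` for `η`
totally positive in `t𝔡⁻¹`, and `a(η) = 0` otherwise. -/
def acoef (r : ℕ) (σ : Fin r → (F →+* ℝ)) (k : Fin r → ℕ) (k0 : ℕ)
    (A : Ideal (𝓞 F) → ℂ) (t : Ideal (𝓞 F)) (η : F) : ℂ :=
  if (η ∈ (t : FractionalIdeal (𝓞 F)⁰ F) *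
      ((differentIdeal ℤ (𝓞 F) : FractionalIdeal (𝓞 F)⁰ F))⁻¹ ∧ ∀ j, 0 < σ j η) then
    (Ideal.absNorm t : ℂ) ^ (k0 / 2) *
    Aext F A (spanSingleton (𝓞 F)⁰ η * ((t : FractionalIdeal (𝓞 F)⁰ F))⁻¹ *
      (differentIdeal ℤ (𝓞 F) : FractionalIdeal (𝓞 F)⁰ F)) *
    ∏ j, ((σ j η : ℝ) : ℂ) ^ (-(((k0 - k j) / 2 : ℕ) : ℤ))
  else 0

/-- The candidate Hilbert modular form
`f(z) = Σ_{ξ ≫ 0, ξ ∈ t𝔡⁻¹} a(ξ) e(tr(ξz))`. -/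
def hilbertF (r : ℕ) (σ : Fin r → (F →+* ℝ)) (k : Fin r → ℕ) (k0 : ℕ)
    (A : Ideal (𝓞 F) → ℂ) (t : Ideal (𝓞 F)) : (Fin r → ℂ) → ℂ :=
  fun z => ∑' ξ : {x : F // x ∈ (t : FractionalIdeal (𝓞 F)⁰ F) *
      ((differentIdeal ℤ (𝓞 F) : FractionalIdeal (𝓞 F)⁰ F))⁻¹ ∧ ∀ j, 0 < σ j x},
    acoef F r σ k k0 A t ξ.1 *
      Complex.exp (2 * Real.pi * Complex.I * ∑ j, ((σ j ξ.1 : ℝ) : ℂ) * z j)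

/-- The Hecke operator at infinity `T^∞_{p,𝓕}`:
`(T^∞_{p,𝓕} g)(z) = ∏_j (p^{(j)})^{k_j+k'_j/2-1} g(pz)
  + ∏_j (p^{(j)})^{k'_j/2-1} Σ_{α∈𝓕} g((z+α)/p)`. -/
def Tinf (r : ℕ) (σ : Fin r → (F →+* ℝ)) (k : Fin r → ℕ) (k0 : ℕ)
    (p : 𝓞 F) (Fs : Finset (𝓞 F)) (g : (Fin r → ℂ) → ℂ) : (Fin r → ℂ) → ℂ :=
  fun z =>
    (∏ j, ((σ j (algebraMap (𝓞 F) F p) : ℝ) : ℂ) ^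
        ((k j : ℤ) + (((k0 - k j) / 2 : ℕ) : ℤ) - 1)) *
      g (fun j => ((σ j (algebraMap (𝓞 F) F p) : ℝ) : ℂ) * z j) +
    (∏ j, ((σ j (algebraMap (𝓞 F) F p) : ℝ) : ℂ) ^ ((((k0 - k j) / 2 : ℕ) : ℤ) - 1)) *
      ∑ α ∈ Fs, g (fun j =>
        (z j + ((σ j (algebraMap (𝓞 F) F α) : ℝ) : ℂ)) /
          ((σ j (algebraMap (𝓞 F) F p) : ℝ) : ℂ))

/-- Membership of a nonzero integral ideal `a` in the narrow ideal class of the fractional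
ideal `I₀`: `a = (ξ)·I₀` for some totally positive `ξ`. -/
def InNarrowClass (r : ℕ) (σ : Fin r → (F →+* ℝ)) (I₀ : FractionalIdeal (𝓞 F)⁰ F)
    (a : Ideal (𝓞 F)) : Prop :=
  ∃ ξ : F, (∀ j, 0 < σ j ξ) ∧
    (a : FractionalIdeal (𝓞 F)⁰ F) = spanSingleton (𝓞 F)⁰ ξ * I₀

namespace HeckeAux

set_option linter.unusedSectionVars false

variable {K : Type*} [Field K] [NumberField K] {r : ℕ}

lemma exists_emb_equiv (hrank : Module.finrank ℚ K = r)
    (σ : Fin r → (K →+* ℝ)) (hσ : Function.Injective σ) :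
    ∃ e : Fin r ≃ (K →ₐ[ℚ] ℂ), ∀ j x, e j x = ((σ j x : ℝ) : ℂ) := by
  let g : Fin r → (K →ₐ[ℚ] ℂ) := fun j => (Complex.ofRealHom.comp (σ j)).toRatAlgHom
  have hg : Function.Injective g := by
    intro i j hij
    apply hσ
    ext x
    have := DFunLike.congr_fun hij x
    exact Complex.ofReal_injective this
  have hcard : Fintype.card (Fin r) = Fintype.card (K →ₐ[ℚ] ℂ) := by
    rw [Fintype.card_fin, AlgHom.card, hrank]
  have hb : Function.Bijective g := (Fintype.bijective_iff_injective_and_card g).2 ⟨hg, hcard⟩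
  exact ⟨Equiv.ofBijective g hb, fun j x => rfl⟩

lemma trace_eq (hrank : Module.finrank ℚ K = r)
    (σ : Fin r → (K →+* ℝ)) (hσ : Function.Injective σ) (x : K) :
    ((Algebra.trace ℚ K x : ℚ) : ℝ) = ∑ j, σ j x := by
  obtain ⟨e, he⟩ := exists_emb_equiv hrank σ hσ
  have h := trace_eq_sum_embeddings (K := ℚ) (L := K) ℂ (x := x)
  rw [← e.sum_comp] at h
  simp only [he] at h
  apply Complex.ofReal_injective
  push_cast
  rw [← h]
  simp

lemma norm_eq (hrank : Module.finrank ℚ K = r)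
    (σ : Fin r → (K →+* ℝ)) (hσ : Function.Injective σ) (x : K) :
    ((Algebra.norm ℚ x : ℚ) : ℝ) = ∏ j, σ j x := by
  obtain ⟨e, he⟩ := exists_emb_equiv hrank σ hσ
  have h := Algebra.norm_eq_prod_embeddings (L := K) ℚ ℂ x
  rw [← e.prod_comp] at h
  simp only [he] at h
  apply Complex.ofReal_injective
  push_cast
  rw [← h]
  simp

lemma mixed_norm_le (hrank : Module.finrank ℚ K = r)
    (σ : Fin r → (K →+* ℝ)) (hσ : Function.Injective σ) (x : K) :
    ‖mixedEmbedding K x‖ ≤ ∑ j, |σ j x| := by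
  obtain ⟨e, he⟩ := exists_emb_equiv hrank σ hσ
  rw [mixedEmbedding.norm_eq_sup'_normAtPlace]
  apply Finset.sup'_le
  intro w _
  rw [mixedEmbedding.normAtPlace_apply]
  obtain ⟨j, hj⟩ := e.surjective (w.embedding.toRatAlgHom)
  have h1 : w x = |σ j x| := by
    rw [← InfinitePlace.norm_embedding_eq]
    have : w.embedding x = e j x := by rw [hj]; rfl
    rw [this, he]
    simp
  rw [h1]
  exact Finset.single_le_sum (f := fun j => |σ j x|) (fun i _ => abs_nonneg _) (Finset.mem_univ j)

lemma mem_inv_different (hrank : Module.finrank ℚ K = r)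
    (σ : Fin r → (K →+* ℝ)) (hσ : Function.Injective σ) (x : K) :
    x ∈ ((differentIdeal ℤ (𝓞 K) : FractionalIdeal (𝓞 K)⁰ K))⁻¹ ↔
      ∀ b : 𝓞 K, ∃ n : ℤ, ∑ j, σ j (x * algebraMap (𝓞 K) K b) = n := by
  rw [coeIdeal_differentIdeal ℤ ℚ K (𝓞 K), inv_inv, FractionalIdeal.mem_dual (one_ne_zero (α := FractionalIdeal (𝓞 K)⁰ K))]
  simp only [← trace_eq hrank σ hσ]
  constructor
  · intro h b
    obtain ⟨n, hn⟩ := h (algebraMap (𝓞 K) K b) (by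
      rw [FractionalIdeal.mem_one_iff]; exact ⟨b, rfl⟩)
    refine ⟨n, ?_⟩
    rw [Algebra.traceForm_apply] at hn
    rw [← hn]; simp
  · intro h a ha
    rw [FractionalIdeal.mem_one_iff] at ha
    obtain ⟨b, rfl⟩ := ha
    obtain ⟨n, hn⟩ := h b
    refine ⟨n, ?_⟩
    rw [Algebra.traceForm_apply]
    have : ((n : ℚ) : ℝ) = ((Algebra.trace ℚ K (x * algebraMap (𝓞 K) K b) : ℚ) : ℝ) := by
      rw [hn]; simp
    have := Rat.cast_injective this
    simpa using this

lemma sum_reps {R : Type*} [CommRing R] (I : Ideal R) (Fs : Finset R)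
    (hFs : ∀ x : R, ∃! α : R, α ∈ Fs ∧ x - α ∈ I)
    (χ : R → ℂ) (hadd : ∀ x y, χ (x + y) = χ x * χ y) (hI : ∀ x ∈ I, χ x = 1)
    (β : R) (hβ : χ β ≠ 1) : ∑ α ∈ Fs, χ α = 0 := by
  choose f hf hfu using fun x => hFs x
  simp only at hf hfu
  have hcong : ∀ x y, x - y ∈ I → χ x = χ y := by
    intro x y h
    have : x = (x - y) + y := by ring
    rw [this, hadd, hI _ h, one_mul]
  have key : ∑ α ∈ Fs, χ (α + β) = ∑ α ∈ Fs, χ α := by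
    refine Finset.sum_bij' (fun α _ => f (α + β)) (fun α _ => f (α - β)) ?_ ?_ ?_ ?_ ?_
    · intro a _; exact (hf _).1
    · intro a _; exact (hf _).1
    · intro a ha
      symm
      apply hfu
      refine ⟨ha, ?_⟩
      have := I.neg_mem (hf (a + β)).2
      convert this using 1; ring
    · intro a ha
      symm
      apply hfu
      refine ⟨ha, ?_⟩
      have := I.neg_mem (hf (a - β)).2
      convert this using 1; ring
    · intro a _
      exact hcong _ _ (hf _).2
  simp only [hadd, ← Finset.sum_mul] at key
  have : (∑ α ∈ Fs, χ α) * (χ β - 1) = 0 := by rw [mul_sub, key]; ring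
  rcases mul_eq_zero.1 this with h | h
  · exact h
  · exact absurd (sub_eq_zero.1 h) hβ

lemma card_reps {R : Type*} [CommRing R] (I : Ideal R) (Fs : Finset R)
    (hFs : ∀ x : R, ∃! α : R, α ∈ Fs ∧ x - α ∈ I) : Fs.card = Nat.card (R ⧸ I) := by
  rw [← Nat.card_eq_finsetCard]
  apply Nat.card_eq_of_bijective (fun a : Fs => Ideal.Quotient.mk I a.1)
  constructor
  · intro a b hab
    obtain ⟨c, _, hc⟩ := hFs a.1
    apply Subtype.ext
    rw [hc a.1 ⟨a.2, by simp⟩, hc b.1 ⟨b.2, (Ideal.Quotient.eq).1 hab⟩]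
  · intro q
    obtain ⟨x, rfl⟩ := Ideal.Quotient.mk_surjective q
    obtain ⟨c, ⟨h1, h2⟩, _⟩ := hFs x
    exact ⟨⟨c, h1⟩, ((Ideal.Quotient.eq).2 h2).symm⟩

lemma exists_reps {R : Type*} [CommRing R] (I : Ideal R) [Finite (R ⧸ I)] :
    ∃ Fs : Finset R, ∀ x : R, ∃! α : R, α ∈ Fs ∧ x - α ∈ I := by
  have := Fintype.ofFinite (R ⧸ I)
  refine ⟨Finset.univ.image (fun q : R ⧸ I => Quotient.out q), fun x => ?_⟩
  have ho : ∀ q : R ⧸ I, Ideal.Quotient.mk I (Quotient.out q) = q := fun q => Quotient.out_eq q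
  refine ⟨Quotient.out (Ideal.Quotient.mk I x), ⟨by simp, ?_⟩, ?_⟩
  · rw [← Ideal.Quotient.eq, ho]
  · rintro y ⟨hy, hxy⟩
    simp only [Finset.mem_image, Finset.mem_univ, true_and] at hy
    obtain ⟨q, rfl⟩ := hy
    rw [← Ideal.Quotient.eq, ho] at hxy
    rw [hxy]


/-- The exponential of the trace. -/
def eTr (σ : Fin r → (K →+* ℝ)) (x : K) : ℂ :=
  Complex.exp (2 * Real.pi * Complex.I * ((∑ j, σ j x : ℝ) : ℂ))

/-- The exponential function `e(tr(ηz))`. -/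
def hE (σ : Fin r → (K →+* ℝ)) (η : K) (z : Fin r → ℂ) : ℂ :=
  Complex.exp (2 * Real.pi * Complex.I * ∑ j, ((σ j η : ℝ) : ℂ) * z j)

lemma eTr_add (σ : Fin r → (K →+* ℝ)) (x y : K) : eTr σ (x + y) = eTr σ x * eTr σ y := by
  unfold eTr
  rw [← Complex.exp_add]
  congr 1
  simp only [map_add, Finset.sum_add_distrib]
  push_cast
  ring

lemma eTr_zero (σ : Fin r → (K →+* ℝ)) : eTr σ 0 = 1 := by
  simp [eTr]

lemma norm_eTr (σ : Fin r → (K →+* ℝ)) (x : K) : ‖eTr σ x‖ = 1 := by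
  unfold eTr
  have : 2 * (Real.pi : ℂ) * Complex.I * ((∑ j, σ j x : ℝ) : ℂ)
    = ((2 * Real.pi * ∑ j, σ j x : ℝ) : ℂ) * Complex.I := by push_cast; ring
  rw [this, Complex.norm_exp_ofReal_mul_I]

lemma eTr_eq_one_iff (σ : Fin r → (K →+* ℝ)) (x : K) :
    eTr σ x = 1 ↔ ∃ n : ℤ, ∑ j, σ j x = n := by
  unfold eTr
  rw [Complex.exp_eq_one_iff]
  apply exists_congr
  intro n
  have h2 : (2 * (Real.pi : ℂ) * Complex.I) ≠ 0 := Complex.two_pi_I_ne_zero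
  rw [mul_comm (n : ℂ), mul_right_inj' h2]
  norm_cast

lemma hE_add_emb (σ : Fin r → (K →+* ℝ)) (η β : K) (z : Fin r → ℂ) :
    hE σ η (fun j => z j + ((σ j β : ℝ) : ℂ)) = hE σ η z * eTr σ (η * β) := by
  unfold hE eTr
  rw [← Complex.exp_add]
  congr 1
  simp only [mul_add, Finset.sum_add_distrib, map_mul]
  push_cast
  ring

lemma hE_mul (σ : Fin r → (K →+* ℝ)) (η β : K) (z : Fin r → ℂ) :
    hE σ η (fun j => ((σ j β : ℝ) : ℂ) * z j) = hE σ (η * β) z := by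
  unfold hE
  simp only [map_mul, Complex.ofReal_mul, mul_assoc]

lemma hE_ne_zero (σ : Fin r → (K →+* ℝ)) (η : K) (z : Fin r → ℂ) : hE σ η z ≠ 0 :=
  Complex.exp_ne_zero _

lemma exists_trace_ne_zero (hr : 1 < r)
    (σ : Fin r → (K →+* ℝ)) (x : K) (hx : x ≠ 0) :
    ∃ b : 𝓞 K, ∑ j, σ j (x * algebraMap (𝓞 K) K b) ≠ 0 := by
  obtain ⟨⟨b, d⟩, h⟩ := IsLocalization.surj (Algebra.algebraMapSubmonoid (𝓞 K) ℤ⁰) x⁻¹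
  refine ⟨b, ?_⟩
  simp only at h
  rw [← h, ← mul_assoc, mul_inv_cancel₀ hx, one_mul]
  obtain ⟨d, n, hn, rfl⟩ := d
  have hn0 : n ≠ 0 := nonZeroDivisors.ne_zero hn
  have : ∀ j, σ j (algebraMap (𝓞 K) K (algebraMap ℤ (𝓞 K) n)) = (n : ℝ) := by
    intro j; simp
  simp only [this]
  simp only [Finset.sum_const, Finset.card_univ, Fintype.card_fin, nsmul_eq_mul]
  have : (r : ℝ) ≠ 0 := by positivity
  have : (n : ℝ) ≠ 0 := by exact_mod_cast hn0
  positivity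

lemma fourier_unique (hr : 1 < r) (hrank : Module.finrank ℚ K = r)
    (σ : Fin r → (K →+* ℝ)) (hσ : Function.Injective σ) (z : Fin r → ℂ) (c : K → ℂ)
    (hsupp : ∀ η, c η ≠ 0 → η ∈ ((differentIdeal ℤ (𝓞 K) : FractionalIdeal (𝓞 K)⁰ K))⁻¹)
    (hsum : Summable fun η => c η * hE σ η z)
    (hzero : ∀ β : K, ∑' η, c η * hE σ η (fun j => z j + ((σ j β : ℝ) : ℂ)) = 0) :
    ∀ η, c η = 0 := by
  intro η₀
  by_contra hc0
  have hη₀ := hsupp η₀ hc0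
  have hfin : ∀ m : ℕ, Finite (𝓞 K ⧸ (Ideal.span {((m + 1 : ℕ) : 𝓞 K)})) := by
    intro m
    apply Ideal.finiteQuotientOfFreeOfNeBot
    rw [Ne, Ideal.span_singleton_eq_bot]
    exact_mod_cast Nat.succ_ne_zero m
  choose Fs hFs using fun m : ℕ => @exists_reps (𝓞 K) _ (Ideal.span {((m + 1 : ℕ) : 𝓞 K)}) (hfin m)
  have hcard : ∀ m, (Fs m).card ≠ 0 := by
    intro m h
    obtain ⟨a, ⟨ha, _⟩, _⟩ := hFs m 0
    rw [Finset.card_eq_zero] at h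
    simp [h] at ha
  let av : ℕ → K → ℂ := fun m x =>
    ((Fs m).card : ℂ)⁻¹ * ∑ α ∈ Fs m, eTr σ (x * (algebraMap (𝓞 K) K α / ((m + 1 : ℕ) : K)))
  have hav0 : ∀ m, av m 0 = 1 := by
    intro m
    simp only [av, zero_mul, eTr_zero, Finset.sum_const, nsmul_eq_mul, mul_one]
    exact inv_mul_cancel₀ (by exact_mod_cast hcard m)
  have hav1 : ∀ m x, ‖av m x‖ ≤ 1 := by
    intro m x
    simp only [av]
    rw [norm_mul, norm_inv, Complex.norm_natCast]
    have : ‖∑ α ∈ Fs m, eTr σ (x * (algebraMap (𝓞 K) K α / ((m + 1 : ℕ) : K)))‖ ≤ (Fs m).card := by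
      refine (norm_sum_le _ _).trans ?_
      simp [norm_eTr]
    have hpos : (0 : ℝ) < (Fs m).card := by exact_mod_cast Nat.pos_of_ne_zero (hcard m)
    rw [inv_mul_le_iff₀ hpos, mul_one]
    exact this
  have hev : ∀ x : K, x ≠ 0 → x ∈ ((differentIdeal ℤ (𝓞 K) : FractionalIdeal (𝓞 K)⁰ K))⁻¹ →
      ∀ᶠ m in Filter.atTop, av m x = 0 := by
    intro x hx0 hx
    have hx' := (mem_inv_different hrank σ hσ x).1 hx
    obtain ⟨b, hb⟩ := exists_trace_ne_zero hr σ x hx0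
    obtain ⟨n, hn⟩ := hx' b
    filter_upwards [Filter.eventually_ge_atTop n.natAbs] with m hm
    have hm0 : ((m + 1 : ℕ) : K) ≠ 0 := by exact_mod_cast Nat.succ_ne_zero m
    have : ∑ α ∈ Fs m, eTr σ (x * (algebraMap (𝓞 K) K α / ((m + 1 : ℕ) : K))) = 0 := by
      refine sum_reps _ (Fs m) (hFs m)
        (fun α => eTr σ (x * (algebraMap (𝓞 K) K α / ((m + 1 : ℕ) : K)))) ?_ ?_ b ?_
      · intro y w
        rw [← eTr_add]
        congr 1
        rw [map_add]; ring
      · intro y hy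
        obtain ⟨w, rfl⟩ := Ideal.mem_span_singleton'.1 hy
        have : algebraMap (𝓞 K) K (w * ((m + 1 : ℕ) : 𝓞 K)) / ((m + 1 : ℕ) : K)
          = algebraMap (𝓞 K) K w := by
          rw [map_mul, map_natCast, mul_div_assoc, div_self hm0, mul_one]
        simp only [this]
        exact (eTr_eq_one_iff σ _).2 (hx' w)
      · rw [Ne, eTr_eq_one_iff]
        rintro ⟨l, hl⟩
        have h1 : ∑ j, σ j (x * (algebraMap (𝓞 K) K b / ((m + 1 : ℕ) : K))) =
            (∑ j, σ j (x * algebraMap (𝓞 K) K b)) / ((m + 1 : ℕ) : ℝ) := by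
          rw [Finset.sum_div]
          refine Finset.sum_congr rfl fun j _ => ?_
          rw [← mul_div_assoc, map_div₀, map_natCast]
        rw [h1, hn] at hl
        have hmR : ((m + 1 : ℕ) : ℝ) ≠ 0 := by exact_mod_cast Nat.succ_ne_zero m
        rw [div_eq_iff hmR] at hl
        have h2 : n = l * ((m + 1 : ℕ) : ℤ) := by exact_mod_cast hl
        have hn0 : n ≠ 0 := by
          rintro rfl
          apply hb; rw [hn]; simp
        have h3 : ((m + 1 : ℕ) : ℤ) ∣ n := ⟨l, by rw [h2]; ring⟩
        have h4 := Nat.le_of_dvd (Int.natAbs_pos.2 hn0) (Int.natCast_dvd.1 h3)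
        omega
    simp only [av, this, mul_zero]
  let f : ℕ → K → ℂ := fun m η => c η * hE σ η z * av m (η - η₀)
  have hlim : Filter.Tendsto (fun m => ∑' η, f m η) Filter.atTop
      (nhds (∑' η, if η = η₀ then c η₀ * hE σ η₀ z else 0)) := by
    refine tendsto_tsum_of_dominated_convergence (bound := fun η => ‖c η * hE σ η z‖)
      hsum.norm ?_ ?_
    · intro η
      by_cases h : η = η₀
      · subst h
        simp [f, hav0]
      · simp only [h, if_false]
        by_cases hcη : c η = 0
        · simp [f, hcη]
        · have := hev (η - η₀) (sub_ne_zero.2 h)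
            (Submodule.sub_mem
              (((differentIdeal ℤ (𝓞 K) : FractionalIdeal (𝓞 K)⁰ K))⁻¹ : FractionalIdeal (𝓞 K)⁰ K).coeToSubmodule
              (hsupp η hcη) hη₀)
          refine tendsto_const_nhds.congr' ?_
          filter_upwards [this] with m hm
          simp [f, hm]
    · refine Filter.Eventually.of_forall fun m η => ?_
      simp only [f]
      rw [norm_mul]
      exact mul_le_of_le_one_right (norm_nonneg _) (hav1 _ _)
  have hz : ∀ m, ∑' η, f m η = 0 := by
    intro m
    have h1 : ∀ η, f m η = ∑ α ∈ Fs m, ((Fs m).card : ℂ)⁻¹ *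
        eTr σ (-η₀ * (algebraMap (𝓞 K) K α / ((m + 1 : ℕ) : K))) *
        (c η * hE σ η (fun j => z j +
          ((σ j (algebraMap (𝓞 K) K α / ((m + 1 : ℕ) : K)) : ℝ) : ℂ))) := by
      intro η
      simp only [f, av]
      rw [Finset.mul_sum, Finset.mul_sum]
      refine Finset.sum_congr rfl fun α _ => ?_
      rw [hE_add_emb, sub_eq_add_neg, add_mul, eTr_add]
      ring
    simp only [h1]
    rw [Summable.tsum_finsetSum]
    · refine Finset.sum_eq_zero fun α _ => ?_
      rw [tsum_mul_left, hzero, mul_zero]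
    · intro α _
      apply Summable.mul_left
      simp only [hE_add_emb, ← mul_assoc]
      refine Summable.of_norm ?_
      simp only [norm_mul _ (eTr _ _), norm_eTr, mul_one]
      exact hsum.norm
  simp only [hz, tsum_ite_eq] at hlim
  have := tendsto_nhds_unique hlim tendsto_const_nhds
  exact mul_ne_zero hc0 (hE_ne_zero σ η₀ z) this

lemma Aext_coe (A : Ideal (𝓞 K) → ℂ) (J : Ideal (𝓞 K)) :
    Aext K A (J : FractionalIdeal (𝓞 K)⁰ K) = A J := by
  unfold Aext
  have h : ∃ J' : Ideal (𝓞 K), (J' : FractionalIdeal (𝓞 K)⁰ K) = J := ⟨J, rfl⟩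
  rw [dif_pos h]
  congr 1
  exact FractionalIdeal.coeIdeal_injective h.choose_spec

lemma diff_ne_zero : (differentIdeal ℤ (𝓞 K) : FractionalIdeal (𝓞 K)⁰ K) ≠ 0 := by
  rw [coeIdeal_differentIdeal ℤ ℚ K (𝓞 K)]
  simp

lemma mem_iff_exists (t : Ideal (𝓞 K)) (ht : t ≠ 0) (η : K) :
    η ∈ (t : FractionalIdeal (𝓞 K)⁰ K) *
      ((differentIdeal ℤ (𝓞 K) : FractionalIdeal (𝓞 K)⁰ K))⁻¹ ↔
    ∃ J : Ideal (𝓞 K), (J : FractionalIdeal (𝓞 K)⁰ K) =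
      spanSingleton (𝓞 K)⁰ η * ((t : FractionalIdeal (𝓞 K)⁰ K))⁻¹ *
      (differentIdeal ℤ (𝓞 K) : FractionalIdeal (𝓞 K)⁰ K) := by
  have ht' : (t : FractionalIdeal (𝓞 K)⁰ K) ≠ 0 := FractionalIdeal.coeIdeal_ne_zero.2 ht
  have hd := diff_ne_zero (K := K)
  rw [← FractionalIdeal.le_one_iff_exists_coeIdeal, ← FractionalIdeal.spanSingleton_le_iff_mem]
  set T := (t : FractionalIdeal (𝓞 K)⁰ K) *
      ((differentIdeal ℤ (𝓞 K) : FractionalIdeal (𝓞 K)⁰ K))⁻¹ with hT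
  have hT0 : T ≠ 0 := mul_ne_zero ht' (inv_ne_zero hd)
  have hTi : spanSingleton (𝓞 K)⁰ η * ((t : FractionalIdeal (𝓞 K)⁰ K))⁻¹ *
      (differentIdeal ℤ (𝓞 K) : FractionalIdeal (𝓞 K)⁰ K) = spanSingleton (𝓞 K)⁰ η * T⁻¹ := by
    rw [hT, mul_inv, inv_inv, mul_assoc]
  rw [hTi]
  constructor
  · intro h
    calc _ ≤ T * T⁻¹ := by gcongr
      _ = 1 := mul_inv_cancel₀ hT0
  · intro h
    calc spanSingleton (𝓞 K)⁰ η = (spanSingleton (𝓞 K)⁰ η * T⁻¹) * T := by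
          rw [mul_assoc, inv_mul_cancel₀ hT0, mul_one]
      _ ≤ 1 * T := by gcongr
      _ = T := one_mul T

lemma acoef_bound (hr : 1 < r) (hrank : Module.finrank ℚ K = r)
    (σ : Fin r → (K →+* ℝ)) (hσ : Function.Injective σ)
    (k : Fin r → ℕ) (k0 : ℕ) (A : Ideal (𝓞 K) → ℂ)
    (hA : ∃ c : ℝ, 0 < c ∧ ∃ M : ℝ, ∀ a : Ideal (𝓞 K), a ≠ 0 →
      ‖A a‖ ≤ M * (Ideal.absNorm a : ℝ) ^ c)
    (t : Ideal (𝓞 K)) (ht : t ≠ 0) :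
    ∃ C : ℝ, 0 ≤ C ∧ ∃ n : ℕ, ∀ η : K, (η ∈ (t : FractionalIdeal (𝓞 K)⁰ K) *
      ((differentIdeal ℤ (𝓞 K) : FractionalIdeal (𝓞 K)⁰ K))⁻¹ ∧ ∀ j, 0 < σ j η) →
      ‖acoef K r σ k k0 A t η‖ ≤ C * (∑ j, σ j η) ^ n := by
  obtain ⟨c, hc, M, hM⟩ := hA
  have ht' : (t : FractionalIdeal (𝓞 K)⁰ K) ≠ 0 := FractionalIdeal.coeIdeal_ne_zero.2 ht
  have hd := diff_ne_zero (K := K)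
  set D : ℝ := (((FractionalIdeal.absNorm (t : FractionalIdeal (𝓞 K)⁰ K))⁻¹ *
    FractionalIdeal.absNorm (differentIdeal ℤ (𝓞 K) : FractionalIdeal (𝓞 K)⁰ K) : ℚ) : ℝ) with hD
  have hD0 : 0 ≤ D := by
    rw [hD]
    have := FractionalIdeal.absNorm_nonneg (t : FractionalIdeal (𝓞 K)⁰ K)
    have := FractionalIdeal.absNorm_nonneg
      (differentIdeal ℤ (𝓞 K) : FractionalIdeal (𝓞 K)⁰ K)
    positivity
  set m : Fin r → ℕ := fun j => (k0 - k j) / 2 with hm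
  set n : ℕ := ⌈c⌉₊ with hn
  refine ⟨(Ideal.absNorm t : ℝ) ^ (k0 / 2) * (|M| * D ^ n) * D ^ (∑ j, m j), by positivity,
    r * n + (r - 1) * ∑ j, m j, ?_⟩
  rintro η ⟨hη, hpos⟩
  obtain ⟨J, hJ⟩ := (mem_iff_exists t ht η).1 hη
  have hη0 : η ≠ 0 := by
    rintro rfl
    have := hpos ⟨0, by omega⟩
    simp at this
  have hJ0 : J ≠ 0 := by
    rintro rfl
    have h1 : spanSingleton (𝓞 K)⁰ η * ((t : FractionalIdeal (𝓞 K)⁰ K))⁻¹ *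
      (differentIdeal ℤ (𝓞 K) : FractionalIdeal (𝓞 K)⁰ K) ≠ 0 :=
      mul_ne_zero (mul_ne_zero (spanSingleton_ne_zero_iff.2 hη0) (inv_ne_zero ht')) hd
    apply h1
    rw [← hJ]; simp
  set S := ∑ j, σ j η with hS
  set P := ∏ j, σ j η with hP
  have hP0 : 0 < P := Finset.prod_pos fun j _ => hpos j
  have hle : ∀ j, σ j η ≤ S := fun j =>
    Finset.single_le_sum (f := fun j => σ j η) (fun i _ => (hpos i).le) (Finset.mem_univ j)
  have hS0 : 0 < S := (hpos ⟨0, by omega⟩).trans_le (hle _)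
  have hNJ : (Ideal.absNorm J : ℝ) = P * D := by
    have h1 := congrArg FractionalIdeal.absNorm hJ
    rw [FractionalIdeal.coeIdeal_absNorm, map_mul, map_mul, map_inv₀,
      FractionalIdeal.absNorm_span_singleton] at h1
    have h2 : ((Ideal.absNorm J : ℚ) : ℝ) = _ := congrArg (fun q : ℚ => (q : ℝ)) h1
    simp only [Rat.cast_natCast] at h2
    rw [h2, hD, mul_assoc]
    rw [Rat.cast_mul, Rat.cast_abs, norm_eq hrank σ hσ, abs_of_pos hP0]
  have hNJ1 : (1 : ℝ) ≤ Ideal.absNorm J := by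
    exact_mod_cast Nat.one_le_iff_ne_zero.2 (by rw [Ne, Ideal.absNorm_eq_zero_iff]; exact hJ0)
  have hPS : P ≤ S ^ r := by
    calc P ≤ ∏ j : Fin r, S := Finset.prod_le_prod (fun j _ => (hpos j).le) (fun j _ => hle j)
      _ = S ^ r := by simp
  have hAJ : ‖A J‖ ≤ |M| * D ^ n * S ^ (r * n) := by
    calc ‖A J‖ ≤ M * (Ideal.absNorm J : ℝ) ^ c := hM J hJ0
      _ ≤ |M| * (Ideal.absNorm J : ℝ) ^ c := by gcongr; exact le_abs_self M
      _ ≤ |M| * (Ideal.absNorm J : ℝ) ^ (n : ℝ) := by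
          refine mul_le_mul_of_nonneg_left ?_ (abs_nonneg M)
          exact Real.rpow_le_rpow_of_exponent_le hNJ1 (Nat.le_ceil c)
      _ = |M| * (P * D) ^ n := by rw [Real.rpow_natCast, hNJ]
      _ ≤ |M| * (S ^ r * D) ^ n := by gcongr
      _ = _ := by rw [mul_pow, ← pow_mul]; ring
  have hinv : ∀ j, (σ j η)⁻¹ ≤ D * S ^ (r - 1) := by
    intro j
    have h1 : σ j η * ∏ i ∈ Finset.univ.erase j, σ i η = P :=
      Finset.mul_prod_erase Finset.univ (fun i => σ i η) (Finset.mem_univ j)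
    have h2 : ∏ i ∈ Finset.univ.erase j, σ i η ≤ S ^ (r - 1) := by
      calc _ ≤ ∏ i ∈ Finset.univ.erase j, S :=
            Finset.prod_le_prod (fun j _ => (hpos j).le) (fun j _ => hle j)
        _ = S ^ (r - 1) := by simp
    rw [inv_le_iff_one_le_mul₀ (hpos j)]
    calc (1 : ℝ) ≤ P * D := hNJ ▸ hNJ1
      _ = D * (∏ i ∈ Finset.univ.erase j, σ i η) * σ j η := by rw [← h1]; ring
      _ ≤ D * S ^ (r - 1) * σ j η := by
        have := (hpos j).le
        gcongr
  have hprod : ‖∏ j, ((σ j η : ℝ) : ℂ) ^ (-(((k0 - k j) / 2 : ℕ) : ℤ))‖ ≤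
      D ^ (∑ j, m j) * S ^ ((r - 1) * ∑ j, m j) := by
    rw [norm_prod]
    calc _ ≤ ∏ j, (D * S ^ (r - 1)) ^ m j := by
          refine Finset.prod_le_prod (fun j _ => norm_nonneg _) (fun j _ => ?_)
          rw [norm_zpow, Complex.norm_real, Real.norm_of_nonneg (hpos j).le, zpow_neg,
            zpow_natCast, ← inv_pow]
          have := (inv_pos.2 (hpos j)).le
          gcongr
          exact hinv j
      _ = _ := by rw [Finset.prod_pow_eq_pow_sum, mul_pow, ← pow_mul]
  unfold acoef
  rw [if_pos ⟨hη, hpos⟩, ← hJ, Aext_coe, norm_mul, norm_mul, norm_pow, Complex.norm_natCast]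
  calc _ ≤ (Ideal.absNorm t : ℝ) ^ (k0 / 2) * (|M| * D ^ n * S ^ (r * n)) *
        (D ^ (∑ j, m j) * S ^ ((r - 1) * ∑ j, m j)) := by gcongr
    _ = _ := by rw [pow_add]; ring

lemma norm_hE (σ : Fin r → (K →+* ℝ)) (η : K) (z : Fin r → ℂ) :
    ‖hE σ η z‖ = Real.exp (-(2 * Real.pi * ∑ j, σ j η * (z j).im)) := by
  unfold hE
  rw [Complex.norm_exp]
  congr 1
  have : 2 * (Real.pi : ℂ) * Complex.I * ∑ j, ((σ j η : ℝ) : ℂ) * z j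
    = ((2 * Real.pi : ℝ) : ℂ) * (Complex.I * ∑ j, ((σ j η : ℝ) : ℂ) * z j) := by push_cast; ring
  rw [this, Complex.re_ofReal_mul, Complex.I_mul_re, Complex.im_sum]
  simp only [Complex.im_ofReal_mul]
  ring

lemma acoef_zero_of_not (σ : Fin r → (K →+* ℝ)) 
    (k : Fin r → ℕ) (k0 : ℕ) (A : Ideal (𝓞 K) → ℂ) (t : Ideal (𝓞 K)) (η : K)
    (h : ¬ (η ∈ (t : FractionalIdeal (𝓞 K)⁰ K) *
      ((differentIdeal ℤ (𝓞 K) : FractionalIdeal (𝓞 K)⁰ K))⁻¹ ∧ ∀ j, 0 < σ j η)) :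
    acoef K r σ k k0 A t η = 0 := by
  unfold acoef
  rw [if_neg h]

lemma summable_acoef (hr : 1 < r) (hrank : Module.finrank ℚ K = r)
    (σ : Fin r → (K →+* ℝ)) (hσ : Function.Injective σ)
    (k : Fin r → ℕ) (k0 : ℕ) (A : Ideal (𝓞 K) → ℂ)
    (hA : ∃ c : ℝ, 0 < c ∧ ∃ M : ℝ, ∀ a : Ideal (𝓞 K), a ≠ 0 →
      ‖A a‖ ≤ M * (Ideal.absNorm a : ℝ) ^ c)
    (t : Ideal (𝓞 K)) (ht : t ≠ 0) (z : Fin r → ℂ) (hz : ∀ j, 0 < (z j).im) :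
    Summable fun η : K => acoef K r σ k k0 A t η * hE σ η z := by
  obtain ⟨C, hC, n, hb⟩ := acoef_bound hr hrank σ hσ k k0 A hA t ht
  have ht' : (t : FractionalIdeal (𝓞 K)⁰ K) ≠ 0 := FractionalIdeal.coeIdeal_ne_zero.2 ht
  have hd := diff_ne_zero (K := K)
  set T := (t : FractionalIdeal (𝓞 K)⁰ K) *
      ((differentIdeal ℤ (𝓞 K) : FractionalIdeal (𝓞 K)⁰ K))⁻¹ with hT
  have hT0 : T ≠ 0 := mul_ne_zero ht' (inv_ne_zero hd)
  let L := mixedEmbedding.idealLattice K (Units.mk0 T hT0)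
  set q : ℕ := Module.finrank ℤ L + 1 with hq
  have hsL : Summable fun x : L => ‖x‖ ^ (-(q : ℝ)) := by
    apply ZLattice.summable_norm_rpow
    rw [hq]; push_cast; linarith
  let X := {x : K // x ∈ T ∧ ∀ j, 0 < σ j x}
  let ι : X → L := fun x => ⟨mixedEmbedding K x.1, by
    rw [mixedEmbedding.mem_idealLattice]
    exact ⟨x.1, x.2.1, rfl⟩⟩
  have hι : Function.Injective ι := by
    intro x y hxy
    apply Subtype.ext
    exact (mixedEmbedding K).injective (congrArg Subtype.val hxy)
  have hsX := hsL.comp_injective hι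
  have : Nonempty (Fin r) := ⟨⟨0, by omega⟩⟩
  obtain ⟨j₀, hj₀⟩ := Finite.exists_min (fun j => (z j).im)
  set δ : ℝ := 2 * Real.pi * (z j₀).im with hδ
  have hδ0 : 0 < δ := by have := hz j₀; positivity
  rw [← Function.Injective.summable_iff (g := (Subtype.val : X → K)) Subtype.val_injective]
  · refine Summable.of_norm_bounded (hsX.mul_left (C * ((n + q).factorial / δ ^ (n + q)))) ?_
    rintro ⟨η, hη⟩
    simp only [Function.comp]
    have hpos := hη.2
    have hη0 : η ≠ 0 := by
      rintro rfl
      have := hpos j₀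
      simp at this
    set S := ∑ j, σ j η with hS
    have hS0 : 0 < S := Finset.sum_pos (fun j _ => hpos j) Finset.univ_nonempty
    have hι1 : ‖ι ⟨η, hη⟩‖ = ‖mixedEmbedding K η‖ := rfl
    have hN0 : 0 < ‖mixedEmbedding K η‖ := norm_pos_iff.2 (by simpa using hη0)
    have hNS : ‖mixedEmbedding K η‖ ≤ S := by
      refine (mixed_norm_le hrank σ hσ η).trans_eq ?_
      exact Finset.sum_congr rfl fun j _ => abs_of_pos (hpos j)
    have hEn : ‖hE σ η z‖ ≤ Real.exp (-(δ * S)) := by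
      rw [norm_hE]
      apply Real.exp_le_exp.2
      apply neg_le_neg
      rw [hδ, mul_assoc, hS, Finset.mul_sum]
      refine mul_le_mul_of_nonneg_left ?_ (by positivity)
      refine Finset.sum_le_sum fun j _ => ?_
      rw [mul_comm]
      exact mul_le_mul_of_nonneg_left (hj₀ j) (hpos j).le
    have hexp : S ^ (n + q) * Real.exp (-(δ * S)) ≤ (n + q).factorial / δ ^ (n + q) := by
      have h1 := Real.pow_div_factorial_le_exp (δ * S) (by positivity) (n + q)
      rw [div_le_iff₀ (by positivity), mul_pow] at h1
      rw [Real.exp_neg, le_div_iff₀ (by positivity), ← div_eq_mul_inv, div_mul_eq_mul_div,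
        div_le_iff₀ (Real.exp_pos _)]
      linarith
    rw [norm_mul, hι1, Real.rpow_neg hN0.le, Real.rpow_natCast]
    calc _ ≤ C * S ^ n * Real.exp (-(δ * S)) := by
          gcongr
          exact hb η hη
      _ = C * (S ^ (n + q) * Real.exp (-(δ * S))) * (S ^ q)⁻¹ := by
          rw [pow_add]; field_simp
      _ ≤ C * ((n + q).factorial / δ ^ (n + q)) * (‖mixedEmbedding K η‖ ^ q)⁻¹ := by
          gcongr
  · intro η hη
    rw [acoef_zero_of_not, zero_mul]
    intro h
    exact hη ⟨⟨η, h⟩, rfl⟩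

lemma hilbertF_eq (σ : Fin r → (K →+* ℝ)) 
    (k : Fin r → ℕ) (k0 : ℕ) (A : Ideal (𝓞 K) → ℂ) (t : Ideal (𝓞 K)) (z : Fin r → ℂ) :
    hilbertF K r σ k k0 A t z = ∑' η : K, acoef K r σ k k0 A t η * hE σ η z := by
  unfold hilbertF
  refine (Subtype.val_injective.tsum_eq (f := fun η : K => acoef K r σ k k0 A t η * hE σ η z) ?_)
  intro η hη
  by_contra h
  apply hη
  simp only
  rw [acoef_zero_of_not, zero_mul]
  intro h'
  exact h ⟨⟨η, h'⟩, rfl⟩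

lemma char_sum (hrank : Module.finrank ℚ K = r)
    (σ : Fin r → (K →+* ℝ)) (hσ : Function.Injective σ)
    (t : Ideal (𝓞 K)) (ht : t ≠ 0) (p : 𝓞 K)
    (hpprime : (Ideal.span {p}).IsPrime) (hp0 : Ideal.span {p} ≠ (⊥ : Ideal (𝓞 K)))
    (hpt : ¬ (Ideal.span {p} ∣ t))
    (Fs : Finset (𝓞 K))
    (hFs : ∀ x : 𝓞 K, ∃! α : 𝓞 K, α ∈ Fs ∧ x - α ∈ Ideal.span {p}) (η : K)
    (hη : η * algebraMap (𝓞 K) K p ∈ (t : FractionalIdeal (𝓞 K)⁰ K) *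
      ((differentIdeal ℤ (𝓞 K) : FractionalIdeal (𝓞 K)⁰ K))⁻¹) :
    ∑ α ∈ Fs, eTr σ (η * algebraMap (𝓞 K) K α) =
      if η ∈ (t : FractionalIdeal (𝓞 K)⁰ K) *
        ((differentIdeal ℤ (𝓞 K) : FractionalIdeal (𝓞 K)⁰ K))⁻¹
      then (Ideal.absNorm (Ideal.span {p}) : ℂ) else 0 := by
  have ht' : (t : FractionalIdeal (𝓞 K)⁰ K) ≠ 0 := FractionalIdeal.coeIdeal_ne_zero.2 ht
  have hd := diff_ne_zero (K := K)
  set d := (differentIdeal ℤ (𝓞 K) : FractionalIdeal (𝓞 K)⁰ K) with hd'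
  have hTle : (t : FractionalIdeal (𝓞 K)⁰ K) * d⁻¹ ≤ d⁻¹ := by
    calc _ ≤ 1 * d⁻¹ := by gcongr; exact FractionalIdeal.coeIdeal_le_one
      _ = _ := one_mul _
  split_ifs with h
  · have h1 := (mem_inv_different hrank σ hσ η).1 (hTle h)
    have h2 : ∀ α ∈ Fs, eTr σ (η * algebraMap (𝓞 K) K α) = 1 := fun α _ =>
      (eTr_eq_one_iff σ _).2 (h1 α)
    rw [Finset.sum_congr rfl h2, Finset.sum_const, nsmul_eq_mul, mul_one, card_reps _ Fs hFs]
    rfl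
  · have hnot : η ∉ d⁻¹ := by
      intro hηd
      apply h
      have hI1 : spanSingleton (𝓞 K)⁰ η * d ≤ 1 := by
        calc _ ≤ d⁻¹ * d := by
              gcongr; exact FractionalIdeal.spanSingleton_le_iff_mem.2 hηd
          _ = 1 := inv_mul_cancel₀ hd
      obtain ⟨I, hI⟩ := FractionalIdeal.le_one_iff_exists_coeIdeal.1 hI1
      have h3 : ((I * Ideal.span {p} : Ideal (𝓞 K)) : FractionalIdeal (𝓞 K)⁰ K) ≤ t := by
        rw [FractionalIdeal.coeIdeal_mul, hI, FractionalIdeal.coeIdeal_span_singleton]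
        calc _ = spanSingleton (𝓞 K)⁰ (η * algebraMap (𝓞 K) K p) * d := by
              rw [← FractionalIdeal.spanSingleton_mul_spanSingleton]; ring
          _ ≤ (t * d⁻¹) * d := by
              gcongr; exact FractionalIdeal.spanSingleton_le_iff_mem.2 hη
          _ = t := by rw [mul_assoc, inv_mul_cancel₀ hd, mul_one]
      have h4 : t ∣ I * Ideal.span {p} :=
        Ideal.dvd_iff_le.2 ((FractionalIdeal.coeIdeal_le_coeIdeal K).1 h3)
      have hmax : (Ideal.span {p}).IsMaximal := hpprime.isMaximal hp0
      have hcop : IsCoprime t (Ideal.span {p}) := by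
        rw [Ideal.isCoprime_iff_sup_eq]
        apply hmax.out.2
        rw [right_lt_sup]
        intro hle
        exact hpt (Ideal.dvd_iff_le.2 hle)
      have h5 : t ∣ I := hcop.dvd_of_dvd_mul_right h4
      have h6 : (I : FractionalIdeal (𝓞 K)⁰ K) ≤ t :=
        (FractionalIdeal.coeIdeal_le_coeIdeal K).2 (Ideal.dvd_iff_le.1 h5)
      rw [← FractionalIdeal.spanSingleton_le_iff_mem]
      calc spanSingleton (𝓞 K)⁰ η = (spanSingleton (𝓞 K)⁰ η * d) * d⁻¹ := by
            rw [mul_assoc, mul_inv_cancel₀ hd, mul_one]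
        _ ≤ _ := by rw [← hI]; gcongr
    rw [mem_inv_different hrank σ hσ] at hnot
    push Not at hnot
    obtain ⟨b, hb⟩ := hnot
    refine sum_reps _ Fs hFs (fun α => eTr σ (η * algebraMap (𝓞 K) K α)) ?_ ?_ b ?_
    · intro x y
      rw [← eTr_add, map_add, mul_add]
    · intro x hx
      obtain ⟨w, rfl⟩ := Ideal.mem_span_singleton'.1 hx
      have h1 := (mem_inv_different hrank σ hσ _).1 (hTle hη) w
      rw [eTr_eq_one_iff]
      have he : η * algebraMap (𝓞 K) K (w * p) =
          η * algebraMap (𝓞 K) K p * algebraMap (𝓞 K) K w := by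
        rw [map_mul]; ring
      rw [he]
      exact h1
    · rw [Ne, eTr_eq_one_iff]
      rintro ⟨n, hn⟩
      exact hb n hn

lemma absNorm_eq_prod (hrank : Module.finrank ℚ K = r)
    (σ : Fin r → (K →+* ℝ)) (hσ : Function.Injective σ) (p : 𝓞 K)
    (hppos : ∀ j, 0 < σ j (algebraMap (𝓞 K) K p)) :
    (Ideal.absNorm (Ideal.span {p}) : ℂ) = ∏ j, ((σ j (algebraMap (𝓞 K) K p) : ℝ) : ℂ) := by
  have h1 := FractionalIdeal.coeIdeal_absNorm (K := K) (Ideal.span {p})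
  rw [FractionalIdeal.coeIdeal_span_singleton, FractionalIdeal.absNorm_span_singleton] at h1
  have h2 := congrArg (fun q : ℚ => (q : ℝ)) h1
  simp only [Rat.cast_natCast, Rat.cast_abs] at h2
  rw [norm_eq hrank σ hσ, abs_of_pos (Finset.prod_pos fun j _ => hppos j)] at h2
  have h3 := congrArg (fun q : ℝ => (q : ℂ)) h2
  push_cast at h3
  exact h3.symm

/-- Fourier coefficients of `T f`. -/
def bcoef (σ : Fin r → (K →+* ℝ)) (k : Fin r → ℕ) (k0 : ℕ)
    (A : Ideal (𝓞 K) → ℂ) (t : Ideal (𝓞 K)) (p : 𝓞 K) (Fs : Finset (𝓞 K)) (η : K) : ℂ :=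
  (∏ j, ((σ j (algebraMap (𝓞 K) K p) : ℝ) : ℂ) ^
        ((k j : ℤ) + (((k0 - k j) / 2 : ℕ) : ℤ) - 1)) *
    acoef K r σ k k0 A t (η * (algebraMap (𝓞 K) K p)⁻¹) +
  (∏ j, ((σ j (algebraMap (𝓞 K) K p) : ℝ) : ℂ) ^ ((((k0 - k j) / 2 : ℕ) : ℤ) - 1)) *
    ∑ α ∈ Fs, acoef K r σ k k0 A t (η * algebraMap (𝓞 K) K p) *
      eTr σ (η * algebraMap (𝓞 K) K α)

lemma hasSum_shift (σ : Fin r → (K →+* ℝ)) (a : K → ℂ) (P : K) (hP : P ≠ 0) (β : K)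
    (z : Fin r → ℂ) (s : ℂ)
    (h : HasSum (fun η => a η * hE σ η (fun j => ((σ j P : ℝ) : ℂ) * (z j + ((σ j β : ℝ) : ℂ)))) s) :
    HasSum (fun η => a (η * P⁻¹) * eTr σ (η * β) * hE σ η z) s := by
  rw [← (Equiv.mulRight₀ P hP).hasSum_iff]
  convert h using 2 with η
  simp only [Function.comp, Equiv.mulRight₀_apply]
  rw [mul_assoc η, mul_inv_cancel₀ hP, mul_one,
    hE_mul σ η P (fun j => z j + ((σ j β : ℝ) : ℂ)), hE_add_emb]
  ring

lemma hasSum_Tinf (hr : 1 < r) (hrank : Module.finrank ℚ K = r)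
    (σ : Fin r → (K →+* ℝ)) (hσ : Function.Injective σ)
    (k : Fin r → ℕ) (k0 : ℕ) (A : Ideal (𝓞 K) → ℂ)
    (hA : ∃ c : ℝ, 0 < c ∧ ∃ M : ℝ, ∀ a : Ideal (𝓞 K), a ≠ 0 →
      ‖A a‖ ≤ M * (Ideal.absNorm a : ℝ) ^ c)
    (t : Ideal (𝓞 K)) (ht : t ≠ 0) (p : 𝓞 K)
    (hppos : ∀ j, 0 < σ j (algebraMap (𝓞 K) K p)) (Fs : Finset (𝓞 K))
    (z : Fin r → ℂ) (hz : ∀ j, 0 < (z j).im) :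
    HasSum (fun η => bcoef σ k k0 A t p Fs η * hE σ η z)
      (Tinf K r σ k k0 p Fs (hilbertF K r σ k k0 A t) z) := by
  have hP : algebraMap (𝓞 K) K p ≠ 0 := by
    intro h
    have := hppos ⟨0, by omega⟩
    simp [h] at this
  have hbase : ∀ w : Fin r → ℂ, (∀ j, 0 < (w j).im) →
      HasSum (fun η => acoef K r σ k k0 A t η * hE σ η w) (hilbertF K r σ k k0 A t w) := by
    intro w hw
    rw [hilbertF_eq]
    exact (summable_acoef hr hrank σ hσ k k0 A hA t ht w hw).hasSum
  have h1 : HasSum (fun η => acoef K r σ k k0 A t (η * (algebraMap (𝓞 K) K p)⁻¹) * hE σ η z)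
      (hilbertF K r σ k k0 A t
        (fun j => ((σ j (algebraMap (𝓞 K) K p) : ℝ) : ℂ) * z j)) := by
    have := hasSum_shift σ (acoef K r σ k k0 A t) _ hP 0 z _ (by
      simp only [map_zero, Complex.ofReal_zero, add_zero]
      apply hbase
      intro j
      rw [Complex.im_ofReal_mul]
      exact mul_pos (hppos j) (hz j))
    simpa only [mul_zero, eTr_zero, mul_one] using this
  have h2 : ∀ α : 𝓞 K, HasSum (fun η => acoef K r σ k k0 A t (η * algebraMap (𝓞 K) K p) *
        eTr σ (η * algebraMap (𝓞 K) K α) * hE σ η z)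
      (hilbertF K r σ k k0 A t (fun j =>
        (z j + ((σ j (algebraMap (𝓞 K) K α) : ℝ) : ℂ)) /
          ((σ j (algebraMap (𝓞 K) K p) : ℝ) : ℂ))) := by
    intro α
    have he : (fun j => (z j + ((σ j (algebraMap (𝓞 K) K α) : ℝ) : ℂ)) /
          ((σ j (algebraMap (𝓞 K) K p) : ℝ) : ℂ)) =
        fun j => ((σ j (algebraMap (𝓞 K) K p)⁻¹ : ℝ) : ℂ) *
          (z j + ((σ j (algebraMap (𝓞 K) K α) : ℝ) : ℂ)) := by
      funext j
      rw [map_inv₀, Complex.ofReal_inv, div_eq_inv_mul]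
    rw [he]
    have := hasSum_shift σ (acoef K r σ k k0 A t) _ (inv_ne_zero hP) (algebraMap (𝓞 K) K α) z _
      (hbase _ (by
        intro j
        rw [Complex.im_ofReal_mul, map_inv₀]
        refine mul_pos (inv_pos.2 (hppos j)) ?_
        simpa using hz j))
    simpa only [inv_inv] using this
  have h3 := (h1.mul_left (∏ j, ((σ j (algebraMap (𝓞 K) K p) : ℝ) : ℂ) ^
        ((k j : ℤ) + (((k0 - k j) / 2 : ℕ) : ℤ) - 1))).add
    ((hasSum_sum (s := Fs) fun α _ => h2 α).mul_left
      (∏ j, ((σ j (algebraMap (𝓞 K) K p) : ℝ) : ℂ) ^ ((((k0 - k j) / 2 : ℕ) : ℤ) - 1)))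
  simp only [bcoef, add_mul, mul_assoc, Finset.sum_mul] at h3 ⊢
  exact h3

lemma bcoef_zero (hr : 1 < r) (hrank : Module.finrank ℚ K = r)
    (σ : Fin r → (K →+* ℝ)) (hσ : Function.Injective σ)
    (k : Fin r → ℕ) (k0 : ℕ) (A : Ideal (𝓞 K) → ℂ)
    (t : Ideal (𝓞 K)) (ht : t ≠ 0) (p : 𝓞 K)
    (hppos : ∀ j, 0 < σ j (algebraMap (𝓞 K) K p))
    (hpprime : (Ideal.span {p}).IsPrime) (hp0 : Ideal.span {p} ≠ (⊥ : Ideal (𝓞 K)))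
    (hpt : ¬ (Ideal.span {p} ∣ t))
    (Fs : Finset (𝓞 K))
    (hFs : ∀ x : 𝓞 K, ∃! α : 𝓞 K, α ∈ Fs ∧ x - α ∈ Ideal.span {p}) (η : K)
    (hη : ¬ (η ∈ (t : FractionalIdeal (𝓞 K)⁰ K) *
      ((differentIdeal ℤ (𝓞 K) : FractionalIdeal (𝓞 K)⁰ K))⁻¹ ∧ ∀ j, 0 < σ j η)) :
    bcoef σ k k0 A t p Fs η = 0 := by
  have hP : algebraMap (𝓞 K) K p ≠ 0 := by
    intro h
    have := hppos ⟨0, by omega⟩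
    simp [h] at this
  unfold bcoef
  rw [acoef_zero_of_not, mul_zero, zero_add, ← Finset.mul_sum]
  · by_cases h : η * algebraMap (𝓞 K) K p ∈ (t : FractionalIdeal (𝓞 K)⁰ K) *
      ((differentIdeal ℤ (𝓞 K) : FractionalIdeal (𝓞 K)⁰ K))⁻¹ ∧
        ∀ j, 0 < σ j (η * algebraMap (𝓞 K) K p)
    · rw [char_sum hrank σ hσ t ht p hpprime hp0 hpt Fs hFs η h.1, if_neg, mul_zero, mul_zero]
      intro h'
      refine hη ⟨h', fun j => ?_⟩
      have := h.2 j
      rw [map_mul] at this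
      exact pos_of_mul_pos_left this (hppos j).le
    · rw [acoef_zero_of_not (h := h), zero_mul, mul_zero]
  · rintro ⟨h1, h2⟩
    apply hη
    have he : η = p • (η * (algebraMap (𝓞 K) K p)⁻¹) := by
      rw [Algebra.smul_def]; field_simp
    constructor
    · rw [he]
      exact Submodule.smul_mem ((t : FractionalIdeal (𝓞 K)⁰ K) *
        ((differentIdeal ℤ (𝓞 K) : FractionalIdeal (𝓞 K)⁰ K))⁻¹ :
          FractionalIdeal (𝓞 K)⁰ K).coeToSubmodule p h1
    · intro j
      rw [he, Algebra.smul_def, map_mul]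
      exact mul_pos (hppos j) (h2 j)

lemma bcoef_eq (hr : 1 < r) (hrank : Module.finrank ℚ K = r)
    (σ : Fin r → (K →+* ℝ)) (hσ : Function.Injective σ)
    (k : Fin r → ℕ) (hk : ∀ j, Even (k j) ∧ 0 < k j)
    (k0 : ℕ) (hk0 : k0 = Finset.univ.sup k) (A : Ideal (𝓞 K) → ℂ)
    (t : Ideal (𝓞 K)) (ht : t ≠ 0) (p : 𝓞 K)
    (hppos : ∀ j, 0 < σ j (algebraMap (𝓞 K) K p))
    (hpprime : (Ideal.span {p}).IsPrime) (hp0 : Ideal.span {p} ≠ (⊥ : Ideal (𝓞 K)))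
    (hpt : ¬ (Ideal.span {p} ∣ t))
    (Fs : Finset (𝓞 K))
    (hFs : ∀ x : 𝓞 K, ∃! α : 𝓞 K, α ∈ Fs ∧ x - α ∈ Ideal.span {p}) (η : K)
    (hη : η ∈ (t : FractionalIdeal (𝓞 K)⁰ K) *
      ((differentIdeal ℤ (𝓞 K) : FractionalIdeal (𝓞 K)⁰ K))⁻¹) (hpos : ∀ j, 0 < σ j η)
    (J : Ideal (𝓞 K)) (hJ : (J : FractionalIdeal (𝓞 K)⁰ K) =
      spanSingleton (𝓞 K)⁰ η * ((t : FractionalIdeal (𝓞 K)⁰ K))⁻¹ *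
      (differentIdeal ℤ (𝓞 K) : FractionalIdeal (𝓞 K)⁰ K)) :
    bcoef σ k k0 A t p Fs η =
      ((Ideal.absNorm t : ℂ) ^ (k0 / 2) *
        ∏ j, ((σ j η : ℝ) : ℂ) ^ (-(((k0 - k j) / 2 : ℕ) : ℤ))) *
      (A (J * Ideal.span {p}) + (Ideal.absNorm (Ideal.span {p}) : ℂ) ^ (k0 - 1) *
              Aext K A ((J : FractionalIdeal (𝓞 K)⁰ K) *
                ((Ideal.span {p} : Ideal (𝓞 K)) : FractionalIdeal (𝓞 K)⁰ K)⁻¹)) := by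
  have hP : algebraMap (𝓞 K) K p ≠ 0 := by
    intro h
    have := hppos ⟨0, by omega⟩
    simp [h] at this
  have hPj : ∀ j, ((σ j (algebraMap (𝓞 K) K p) : ℝ) : ℂ) ≠ 0 := fun j => by
    exact_mod_cast (hppos j).ne'
  have hηP : η * algebraMap (𝓞 K) K p ∈ (t : FractionalIdeal (𝓞 K)⁰ K) *
      ((differentIdeal ℤ (𝓞 K) : FractionalIdeal (𝓞 K)⁰ K))⁻¹ := by
    rw [mul_comm η, ← Algebra.smul_def]
    exact Submodule.smul_mem ((t : FractionalIdeal (𝓞 K)⁰ K) *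
        ((differentIdeal ℤ (𝓞 K) : FractionalIdeal (𝓞 K)⁰ K))⁻¹ :
          FractionalIdeal (𝓞 K)⁰ K).coeToSubmodule p hη
  have hN := absNorm_eq_prod hrank σ hσ p hppos
  have hkk : ∀ j, k j + 2 * ((k0 - k j) / 2) = k0 := by
    intro j
    have h1 : k j ≤ k0 := hk0 ▸ Finset.le_sup (Finset.mem_univ j)
    have h2 : Even k0 := by
      obtain ⟨i, _, hi⟩ := Finset.exists_mem_eq_sup Finset.univ ⟨j, Finset.mem_univ j⟩ k
      rw [hk0, hi]; exact (hk i).1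
    obtain ⟨u, hu⟩ := (hk j).1
    obtain ⟨v, hv⟩ := h2
    omega
  have hk01 : 1 ≤ k0 := by
    have := hkk ⟨0, by omega⟩
    have := (hk ⟨0, by omega⟩).2
    omega
  unfold bcoef
  rw [← Finset.mul_sum, char_sum hrank σ hσ t ht p hpprime hp0 hpt Fs hFs η hηP, if_pos hη,
    mul_add, add_comm]
  congr 1
  · have hpos' : ∀ j, 0 < σ j (η * algebraMap (𝓞 K) K p) := fun j => by
      rw [map_mul]; exact mul_pos (hpos j) (hppos j)
    have hid : spanSingleton (𝓞 K)⁰ (η * algebraMap (𝓞 K) K p) *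
        ((t : FractionalIdeal (𝓞 K)⁰ K))⁻¹ *
        (differentIdeal ℤ (𝓞 K) : FractionalIdeal (𝓞 K)⁰ K) =
        ((J * Ideal.span {p} : Ideal (𝓞 K)) : FractionalIdeal (𝓞 K)⁰ K) := by
      rw [FractionalIdeal.coeIdeal_mul, hJ, FractionalIdeal.coeIdeal_span_singleton,
        ← FractionalIdeal.spanSingleton_mul_spanSingleton]
      ring
    unfold acoef
    rw [if_pos ⟨hηP, hpos'⟩, hid, Aext_coe, hN]
    simp only [map_mul, Complex.ofReal_mul, mul_zpow, Finset.prod_mul_distrib]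
    have h1 : (∏ j, ((σ j (algebraMap (𝓞 K) K p) : ℝ) : ℂ) ^ ((((k0 - k j) / 2 : ℕ) : ℤ) - 1)) *
        (∏ j, ((σ j (algebraMap (𝓞 K) K p) : ℝ) : ℂ) ^ (-(((k0 - k j) / 2 : ℕ) : ℤ))) *
        (∏ j, ((σ j (algebraMap (𝓞 K) K p) : ℝ) : ℂ)) = 1 := by
      rw [← Finset.prod_mul_distrib, ← Finset.prod_mul_distrib]
      refine Finset.prod_eq_one fun j _ => ?_
      rw [← zpow_add₀ (hPj j), ← zpow_add_one₀ (hPj j)]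
      convert zpow_zero _ using 2
      ring
    linear_combination ((Ideal.absNorm t : ℂ) ^ (k0 / 2) *
        (∏ j, ((σ j η : ℝ) : ℂ) ^ (-(((k0 - k j) / 2 : ℕ) : ℤ))) * A (J * Ideal.span {p})) * h1
  · have hpos' : ∀ j, 0 < σ j (η * (algebraMap (𝓞 K) K p)⁻¹) := fun j => by
      rw [map_mul, map_inv₀]; exact mul_pos (hpos j) (inv_pos.2 (hppos j))
    have hid : spanSingleton (𝓞 K)⁰ (η * (algebraMap (𝓞 K) K p)⁻¹) *
        ((t : FractionalIdeal (𝓞 K)⁰ K))⁻¹ *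
        (differentIdeal ℤ (𝓞 K) : FractionalIdeal (𝓞 K)⁰ K) =
        (J : FractionalIdeal (𝓞 K)⁰ K) *
                ((Ideal.span {p} : Ideal (𝓞 K)) : FractionalIdeal (𝓞 K)⁰ K)⁻¹ := by
      rw [hJ, FractionalIdeal.coeIdeal_span_singleton,
        ← FractionalIdeal.spanSingleton_mul_spanSingleton, FractionalIdeal.spanSingleton_inv]
      ring
    have h1 : (∏ j, ((σ j (algebraMap (𝓞 K) K p) : ℝ) : ℂ) ^
        ((k j : ℤ) + (((k0 - k j) / 2 : ℕ) : ℤ) - 1)) *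
        (∏ j, (((σ j (algebraMap (𝓞 K) K p) : ℝ) : ℂ)⁻¹) ^ (-(((k0 - k j) / 2 : ℕ) : ℤ))) =
        (∏ j, ((σ j (algebraMap (𝓞 K) K p) : ℝ) : ℂ)) ^ (k0 - 1) := by
      rw [← Finset.prod_mul_distrib, ← Finset.prod_pow]
      refine Finset.prod_congr rfl fun j _ => ?_
      rw [inv_zpow, zpow_neg, inv_inv, ← zpow_add₀ (hPj j), ← zpow_natCast]
      congr 1
      have := hkk j
      omega
    by_cases hin : η * (algebraMap (𝓞 K) K p)⁻¹ ∈ (t : FractionalIdeal (𝓞 K)⁰ K) *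
      ((differentIdeal ℤ (𝓞 K) : FractionalIdeal (𝓞 K)⁰ K))⁻¹
    · unfold acoef
      rw [if_pos ⟨hin, hpos'⟩, hid, hN, ← h1]
      simp only [map_mul, map_inv₀, Complex.ofReal_mul, Complex.ofReal_inv, mul_zpow,
        Finset.prod_mul_distrib]
      ring
    · rw [acoef_zero_of_not (h := fun h => hin h.1), ← hid]
      have : Aext K A (spanSingleton (𝓞 K)⁰ (η * (algebraMap (𝓞 K) K p)⁻¹) *
        ((t : FractionalIdeal (𝓞 K)⁰ K))⁻¹ *
        (differentIdeal ℤ (𝓞 K) : FractionalIdeal (𝓞 K)⁰ K)) = 0 := by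
        unfold Aext
        rw [dif_neg]
        intro h
        exact hin ((mem_iff_exists t ht _).2 h)
      rw [this]
      ring

end HeckeAux

/-- **Hecke eigenfunction ⇔ coefficient recursion (Proposition `eigenfourier`).**
`T^∞_{p,𝓕} f = A(𝔭)·f` if and only if
`A(𝔞)A(𝔭) = A(𝔞𝔭) + N(𝔭)^{k₀-1} A(𝔞𝔭⁻¹)` for all nonzero integral ideals `𝔞` in the
narrow class of `t⁻¹𝔡`, with the convention `A(𝔟) = 0` for non-integral `𝔟`. -/
theorem stmt_10 (F : Type*) [Field F] [NumberField F]
    (r : ℕ) (hr : 1 < r) (hrank : Module.finrank ℚ F = r)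
    (σ : Fin r → (F →+* ℝ)) (hσ : Function.Injective σ)
    (k : Fin r → ℕ) (hk : ∀ j, Even (k j) ∧ 0 < k j)
    (k0 : ℕ) (hk0 : k0 = Finset.univ.sup k)
    (A : Ideal (𝓞 F) → ℂ)
    (hA : ∃ c : ℝ, 0 < c ∧ ∃ M : ℝ, ∀ a : Ideal (𝓞 F), a ≠ 0 →
      ‖A a‖ ≤ M * (Ideal.absNorm a : ℝ) ^ c)
    (t : Ideal (𝓞 F)) (ht : t ≠ 0)
    (p : 𝓞 F) (hppos : ∀ j, 0 < σ j (algebraMap (𝓞 F) F p))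
    (hpprime : (Ideal.span {p}).IsPrime) (hp0 : Ideal.span {p} ≠ (⊥ : Ideal (𝓞 F)))
    (hpt : ¬ (Ideal.span {p} ∣ t))
    (Fs : Finset (𝓞 F))
    (hFs : ∀ x : 𝓞 F, ∃! α : 𝓞 F, α ∈ Fs ∧ x - α ∈ Ideal.span {p}) :
    (∀ z : Fin r → ℂ, (∀ j, 0 < (z j).im) →
        Tinf F r σ k k0 p Fs (hilbertF F r σ k k0 A t) z =
          A (Ideal.span {p}) * hilbertF F r σ k k0 A t z) ↔
      (∀ a : Ideal (𝓞 F), a ≠ 0 →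
        InNarrowClass F r σ (((t : FractionalIdeal (𝓞 F)⁰ F))⁻¹ *
          (differentIdeal ℤ (𝓞 F) : FractionalIdeal (𝓞 F)⁰ F)) a →
        A a * A (Ideal.span {p}) =
          A (a * Ideal.span {p}) +
            (Ideal.absNorm (Ideal.span {p}) : ℂ) ^ (k0 - 1) *
              Aext F A ((a : FractionalIdeal (𝓞 F)⁰ F) *
                ((Ideal.span {p} : Ideal (𝓞 F)) : FractionalIdeal (𝓞 F)⁰ F)⁻¹)) := by
  have main : (∀ z : Fin r → ℂ, (∀ j, 0 < (z j).im) →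
        Tinf F r σ k k0 p Fs (hilbertF F r σ k k0 A t) z =
          A (Ideal.span {p}) * hilbertF F r σ k k0 A t z) ↔
      ∀ η : F, HeckeAux.bcoef σ k k0 A t p Fs η =
        A (Ideal.span {p}) * acoef F r σ k k0 A t η := by
    have hf : ∀ z : Fin r → ℂ, (∀ j, 0 < (z j).im) →
        HasSum (fun η => A (Ideal.span {p}) * acoef F r σ k k0 A t η * HeckeAux.hE σ η z)
          (A (Ideal.span {p}) * hilbertF F r σ k k0 A t z) := by
      intro z hz
      rw [HeckeAux.hilbertF_eq]
      simp only [mul_assoc]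
      exact ((HeckeAux.summable_acoef hr hrank σ hσ k k0 A hA t ht z hz).hasSum).mul_left _
    have hT : ∀ z : Fin r → ℂ, (∀ j, 0 < (z j).im) → _ := fun z hz =>
      HeckeAux.hasSum_Tinf hr hrank σ hσ k k0 A hA t ht p hppos Fs z hz
    constructor
    · intro h
      have hs : ∀ z : Fin r → ℂ, (∀ j, 0 < (z j).im) →
          HasSum (fun η => (HeckeAux.bcoef σ k k0 A t p Fs η -
            A (Ideal.span {p}) * acoef F r σ k k0 A t η) * HeckeAux.hE σ η z) 0 := by
        intro z hz
        have h1 := (hT z hz).sub (hf z hz)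
        rw [h z hz, sub_self] at h1
        simpa only [sub_mul] using h1
      have hu := HeckeAux.fourier_unique hr hrank σ hσ (fun _ => Complex.I)
        (fun η => HeckeAux.bcoef σ k k0 A t p Fs η -
            A (Ideal.span {p}) * acoef F r σ k k0 A t η) ?_ ?_ ?_
      · exact fun η => sub_eq_zero.1 (hu η)
      · intro η hne
        have hX : η ∈ (t : FractionalIdeal (𝓞 F)⁰ F) *
            ((differentIdeal ℤ (𝓞 F) : FractionalIdeal (𝓞 F)⁰ F))⁻¹ ∧ ∀ j, 0 < σ j η := by
          by_contra hX
          apply hne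
          rw [HeckeAux.acoef_zero_of_not (h := hX),
            HeckeAux.bcoef_zero hr hrank σ hσ k k0 A t ht p hppos hpprime hp0 hpt Fs hFs η hX]
          simp
        have hTle : (t : FractionalIdeal (𝓞 F)⁰ F) *
            ((differentIdeal ℤ (𝓞 F) : FractionalIdeal (𝓞 F)⁰ F))⁻¹ ≤
            ((differentIdeal ℤ (𝓞 F) : FractionalIdeal (𝓞 F)⁰ F))⁻¹ := by
          calc _ ≤ 1 * ((differentIdeal ℤ (𝓞 F) : FractionalIdeal (𝓞 F)⁰ F))⁻¹ := by
                gcongr; exact FractionalIdeal.coeIdeal_le_one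
            _ = _ := one_mul _
        exact hTle hX.1
      · exact (hs (fun _ => Complex.I) (by simp)).summable
      · intro β
        exact (hs _ (by simp)).tsum_eq
    · intro h z hz
      have h1 := hT z hz
      simp only [h] at h1
      exact h1.unique (hf z hz)
  rw [main]
  have hη0 : ∀ η : F, (∀ j, 0 < σ j η) → η ≠ 0 := by
    rintro η hη rfl
    have := hη ⟨0, by omega⟩
    simp at this
  have hW : ∀ η : F, (∀ j, 0 < σ j η) → ((Ideal.absNorm t : ℂ) ^ (k0 / 2) *
        ∏ j, ((σ j η : ℝ) : ℂ) ^ (-(((k0 - k j) / 2 : ℕ) : ℤ))) ≠ 0 := by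
    intro η hη
    apply mul_ne_zero
    · apply pow_ne_zero
      rw [Nat.cast_ne_zero, Ne, Ideal.absNorm_eq_zero_iff]
      exact ht
    · refine Finset.prod_ne_zero_iff.2 fun j _ => zpow_ne_zero _ ?_
      exact_mod_cast (hη j).ne'
  have ha : ∀ η : F, (∀ j, 0 < σ j η) → ∀ J : Ideal (𝓞 F), (J : FractionalIdeal (𝓞 F)⁰ F) =
      spanSingleton (𝓞 F)⁰ η * ((t : FractionalIdeal (𝓞 F)⁰ F))⁻¹ *
      (differentIdeal ℤ (𝓞 F) : FractionalIdeal (𝓞 F)⁰ F) →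
      acoef F r σ k k0 A t η = ((Ideal.absNorm t : ℂ) ^ (k0 / 2) *
        ∏ j, ((σ j η : ℝ) : ℂ) ^ (-(((k0 - k j) / 2 : ℕ) : ℤ))) * A J := by
    intro η hη J hJ
    unfold acoef
    rw [if_pos ⟨(HeckeAux.mem_iff_exists t ht η).2 ⟨J, hJ⟩, hη⟩, ← hJ, HeckeAux.Aext_coe]
    ring
  constructor
  · rintro h a ha0 ⟨ξ, hξ, hξa⟩
    rw [← mul_assoc] at hξa
    have h1 := h ξ
    rw [HeckeAux.bcoef_eq hr hrank σ hσ k hk k0 hk0 A t ht p hppos hpprime hp0 hpt Fs hFs ξ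
      ((HeckeAux.mem_iff_exists t ht ξ).2 ⟨a, hξa⟩) hξ a hξa, ha ξ hξ a hξa] at h1
    apply mul_left_cancel₀ (hW ξ hξ)
    rw [h1]
    ring
  · intro h η
    by_cases hX : η ∈ (t : FractionalIdeal (𝓞 F)⁰ F) *
            ((differentIdeal ℤ (𝓞 F) : FractionalIdeal (𝓞 F)⁰ F))⁻¹ ∧ ∀ j, 0 < σ j η
    · obtain ⟨J, hJ⟩ := (HeckeAux.mem_iff_exists t ht η).1 hX.1
      have hJ0 : J ≠ 0 := by
        rintro rfl
        have h1 : spanSingleton (𝓞 F)⁰ η * ((t : FractionalIdeal (𝓞 F)⁰ F))⁻¹ *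
          (differentIdeal ℤ (𝓞 F) : FractionalIdeal (𝓞 F)⁰ F) ≠ 0 :=
          mul_ne_zero (mul_ne_zero (spanSingleton_ne_zero_iff.2 (hη0 η hX.2))
            (inv_ne_zero (FractionalIdeal.coeIdeal_ne_zero.2 ht))) HeckeAux.diff_ne_zero
        apply h1
        rw [← hJ]; simp
      rw [HeckeAux.bcoef_eq hr hrank σ hσ k hk k0 hk0 A t ht p hppos hpprime hp0 hpt Fs hFs η
        hX.1 hX.2 J hJ, ha η hX.2 J hJ,
        ← h J hJ0 ⟨η, hX.2, by rw [← mul_assoc]; exact hJ⟩]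
      ring
    · rw [HeckeAux.acoef_zero_of_not (h := hX),
        HeckeAux.bcoef_zero hr hrank σ hσ k k0 A t ht p hppos hpprime hp0 hpt Fs hFs η hX,
        mul_zero]
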